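/- arXiv:alg-geom/9412009 — 2 statements merged into one kernel-verified Lean document; each statement's English description precedes it below -/
import Mathlib

section
/- Let B = (H_{i_1}, …, H_{i_r}) be a standard ordered nbc-base of 𝒜, and let ξ = (X_1 > ⋯ > X_r) be any chain of r elements of L ∖ {V} such that {min 𝒜_{X_1}, …, min 𝒜_{X_r}} equals the underlying set of B. Then ξ = ξ(B), i.e. X_p = ⋂_{k=p}^{r} H_{i_k} for all 1 ≤ p ≤ r. -/
open Module

noncomputable section

/-- An arrangement of `n` (affine) hyperplanes inside the ambient affine subspace `amb`
of the complex vector space `W`.  The linear order on the hyperplanes is the order of the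
indices in `Fin n`; an arbitrary linear order is encoded by a permutation `σ` of `Fin n`,
with `i ≺ j ↔ σ i < σ j`. -/
structure HArr (W : Type) [AddCommGroup W] [Module ℂ W] (n : ℕ) where
  amb : AffineSubspace ℂ W
  amb_ne : (amb : Set W).Nonempty
  H : Fin n → AffineSubspace ℂ W
  inj : Function.Injective H
  le_amb : ∀ i, H i ≤ amb
  nonemptyH : ∀ i, ((H i : Set W)).Nonempty
  hyp : ∀ i, finrank ℂ (H i).direction + 1 = finrank ℂ amb.direction

namespace HArr

variable {W : Type} [AddCommGroup W] [Module ℂ W] {n : ℕ}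

/-- The intersection `⋂ S` of a subset of the arrangement (the ambient space for `S = ∅`). -/
def inter (A : HArr W n) (S : Finset (Fin n)) : AffineSubspace ℂ W :=
  A.amb ⊓ S.inf A.H

/-- Codimension (inside the ambient space) of an affine subspace. -/
def cd (A : HArr W n) (X : AffineSubspace ℂ W) : ℕ :=
  finrank ℂ A.amb.direction - finrank ℂ X.direction

/-- A dependent subset of the arrangement. -/
def dep (A : HArr W n) (S : Finset (Fin n)) : Prop :=
  A.inter S ≠ ⊥ ∧ A.cd (A.inter S) < S.card

/-- An independent subset of the arrangement. -/
def indep (A : HArr W n) (S : Finset (Fin n)) : Prop :=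
  A.inter S ≠ ⊥ ∧ A.cd (A.inter S) = S.card

/-- A base: a maximal independent subset. -/
def isBase (A : HArr W n) (S : Finset (Fin n)) : Prop :=
  A.indep S ∧ ∀ T, A.indep T → S ⊆ T → S = T

open scoped Classical in
/-- The rank of a subarrangement `{H i : i ∈ C}`. -/
def rankOn (A : HArr W n) (C : Finset (Fin n)) : ℕ :=
  C.powerset.sup fun S => if A.indep S then S.card else 0

/-- The rank `r` of the arrangement. -/
def rank (A : HArr W n) : ℕ := A.rankOn Finset.univ

/-- A circuit: an inclusion-minimal dependent set. -/
def circuit (A : HArr W n) (S : Finset (Fin n)) : Prop :=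
  A.dep S ∧ ∀ T ⊂ S, ¬ A.dep T

/-- A broken circuit w.r.t. the linear order given by `σ`. -/
def brokenCircuit (A : HArr W n) (σ : Equiv.Perm (Fin n)) (S : Finset (Fin n)) : Prop :=
  ∃ i ∉ S, (∀ j ∈ S, σ i < σ j) ∧ A.circuit (insert i S)

/-- An nbc set: nonempty intersection and containing no broken circuit. -/
def nbcSet (A : HArr W n) (σ : Equiv.Perm (Fin n)) (S : Finset (Fin n)) : Prop :=
  A.inter S ≠ ⊥ ∧ ∀ T ⊆ S, ¬ A.brokenCircuit σ T

/-- An nbc-base. -/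
def nbcBase (A : HArr W n) (σ : Equiv.Perm (Fin n)) (S : Finset (Fin n)) : Prop :=
  A.nbcSet σ S ∧ A.isBase S

/-- A βnbc-base. -/
def betaNbcBase (A : HArr W n) (σ : Equiv.Perm (Fin n)) (S : Finset (Fin n)) : Prop :=
  A.nbcBase σ S ∧ ∀ i ∈ S, ∃ j, σ j < σ i ∧ A.isBase (insert j (S.erase i))

/-- Membership in the intersection poset `L(𝒜)`. -/
def memL (A : HArr W n) (X : AffineSubspace ℂ W) : Prop :=
  X ≠ ⊥ ∧ ∃ S : Finset (Fin n), A.inter S = X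

/-- A maximal element of `L(𝒜)` (in the reverse-inclusion order). -/
def maximalL (A : HArr W n) (X : AffineSubspace ℂ W) : Prop :=
  A.memL X ∧ ∀ Y, A.memL Y → Y ≤ X → Y = X

open scoped Classical in
/-- The set of indices of hyperplanes containing `X`, i.e. `𝒜_X`. -/
def sub (A : HArr W n) (X : AffineSubspace ℂ W) : Finset (Fin n) :=
  Finset.univ.filter fun i => X ≤ A.H i

/-- `X` is dense: `𝒜_X` admits no decomposition into two nonempty parts. -/
def denseL (A : HArr W n) (X : AffineSubspace ℂ W) : Prop :=
  ¬ ∃ S T : Finset (Fin n), Disjoint S T ∧ S.Nonempty ∧ T.Nonempty ∧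
      S ∪ T = A.sub X ∧ A.cd (A.inter S) + A.cd (A.inter T) = A.cd X

/-- `i` is the minimum of `S` w.r.t. the linear order given by `σ`. -/
def isMin (σ : Equiv.Perm (Fin n)) (i : Fin n) (S : Finset (Fin n)) : Prop :=
  i ∈ S ∧ ∀ j ∈ S, σ i ≤ σ j

/-- The standard ordered tuple of a finite set, w.r.t. the linear order given by `σ`:
`tup σ S p` is the element of `S` with `(p+1)`-st smallest `σ`-value. -/
def tup (σ : Equiv.Perm (Fin n)) (S : Finset (Fin n)) (p : Fin S.card) : Fin n :=
  σ.symm (((S.image ⇑σ).orderIsoOfFin (Finset.card_image_of_injective S σ.injective) p).1)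

/-- The flag `ξ(B) = (X_1 > ⋯ > X_r)` of a standard ordered base:
`flag σ S p = X_{p+1} = ⋂_{k ≥ p} H_{i_k}`. -/
def flag (A : HArr W n) (σ : Equiv.Perm (Fin n)) (S : Finset (Fin n)) (p : Fin S.card) :
    AffineSubspace ℂ W :=
  A.inter (S.filter fun i => σ (tup σ S p) ≤ σ i)

/-- Lexicographic order on standard ordered tuples (for the canonical order). -/
def lexLt (S T : Finset (Fin n)) : Prop :=
  List.Lex (· < ·) (S.sort (· ≤ ·)) (T.sort (· ≤ ·))

/-- `λ(X) = Σ_{H_i ∈ 𝒜_X} λ_i`. -/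
def lamX (A : HArr W n) (lam : Fin n → ℂ) (X : AffineSubspace ℂ W) : ℂ :=
  ∑ i ∈ A.sub X, lam i

/-- `X` is unmixed (w.r.t. the order `σ`). -/
def unmixedX (A : HArr W n) (σ : Equiv.Perm (Fin n)) (X : AffineSubspace ℂ W) : Prop :=
  (∀ S, A.nbcBase σ S → A.inter S = X → A.betaNbcBase σ S) ∨
  (∀ S, A.nbcBase σ S → A.inter S = X → ¬ A.betaNbcBase σ S)

/-- The linear order given by `σ` is unmixed. -/
def unmixedOrd (A : HArr W n) (σ : Equiv.Perm (Fin n)) : Prop :=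
  ∀ X, A.maximalL X → A.unmixedX σ X

/-- Membership in the intersection poset of the deleted arrangement `𝒜 ∖ {H_{i₀}}`. -/
def memLdel (A : HArr W n) (i₀ : Fin n) (X : AffineSubspace ℂ W) : Prop :=
  X ≠ ⊥ ∧ ∃ S : Finset (Fin n), i₀ ∉ S ∧ A.inter S = X

/-- A maximal element of the intersection poset of the deleted arrangement. -/
def maximalLdel (A : HArr W n) (i₀ : Fin n) (X : AffineSubspace ℂ W) : Prop :=
  A.memLdel i₀ X ∧ ∀ Y, A.memLdel i₀ Y → Y ≤ X → Y = X

/-- The generator `e_i` of the exterior algebra `E`. -/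
def gen (i : Fin n) : ExteriorAlgebra ℂ (Fin n → ℂ) :=
  ExteriorAlgebra.ι ℂ (Pi.single i 1)

/-- `e_S = e_{i_1} ∧ ⋯ ∧ e_{i_p}` for `S = {i_1 < ⋯ < i_p}`. -/
def eS (S : Finset (Fin n)) : ExteriorAlgebra ℂ (Fin n → ℂ) :=
  ((S.sort (· ≤ ·)).map gen).prod

/-- `∂e_S = Σ_k (−1)^{k−1} e_{S ∖ {i_k}}`. -/
def bdry (S : Finset (Fin n)) : ExteriorAlgebra ℂ (Fin n → ℂ) :=
  ∑ i ∈ S, ((-1 : ℂ) ^ (S.filter fun j => j < i).card) • eS (S.erase i)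

/-- The defining relations of the Orlik–Solomon algebra. -/
inductive OSRel (A : HArr W n) :
    ExteriorAlgebra ℂ (Fin n → ℂ) → ExteriorAlgebra ℂ (Fin n → ℂ) → Prop
  | isBot : ∀ S : Finset (Fin n), A.inter S = ⊥ → OSRel A (eS S) 0
  | isDep : ∀ S : Finset (Fin n), A.dep S → OSRel A (bdry S) 0

/-- The Orlik–Solomon algebra `A(𝒜)`: the exterior algebra modulo the ideal generated by
the `e_S` with empty intersection and the `∂e_S` with `S` dependent. -/
abbrev OS (A : HArr W n) := RingQuot (OSRel A)

/-- The quotient map `E → A(𝒜)`. -/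
def osMk (A : HArr W n) : ExteriorAlgebra ℂ (Fin n → ℂ) →ₐ[ℂ] OS A :=
  RingQuot.mkAlgHom ℂ (OSRel A)

/-- `ω_i`, the image of `e_i` in the Orlik–Solomon algebra. -/
def om (A : HArr W n) (i : Fin n) : OS A := osMk A (gen i)

/-- `ω_B`, the image of `e_B` in the Orlik–Solomon algebra. -/
def omB (A : HArr W n) (S : Finset (Fin n)) : OS A := osMk A (eS S)

/-- The degree `p` part `A^p` of the Orlik–Solomon algebra. -/
def deg (A : HArr W n) (p : ℕ) : Submodule ℂ (OS A) :=
  Submodule.span ℂ {x | ∃ S : Finset (Fin n), S.card = p ∧ x = omB A S}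

/-- `ω_λ = Σ_i λ_i ω_i`. -/
def omLam (A : HArr W n) (lam : Fin n → ℂ) : OS A := ∑ i, lam i • om A i

/-- `ω_λ(X) = Σ_{H_i ∈ 𝒜_X} λ_i ω_i`. -/
def omLamX (A : HArr W n) (lam : Fin n → ℂ) (X : AffineSubspace ℂ W) : OS A :=
  ∑ i ∈ A.sub X, lam i • om A i

/-- The form `Ξ(B) = ω_λ(X_1) ⋯ ω_λ(X_r)` attached to a standard ordered base. -/
def Xi (A : HArr W n) (σ : Equiv.Perm (Fin n)) (lam : Fin n → ℂ) (S : Finset (Fin n)) :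
    OS A :=
  ((List.finRange S.card).map fun p => A.omLamX lam (A.flag σ S p)).prod

/-- The submodule `ω_λ ∧ A^p` of the Orlik-Solomon algebra. -/
def Ideg (A : HArr W n) (lam : Fin n → ℂ) (p : ℕ) : Submodule ℂ (OS A) :=
  (A.deg p).map (LinearMap.mulLeft ℂ (A.omLam lam))

end HArr

namespace HArr

variable {W : Type} [AddCommGroup W] [Module ℂ W] {n : ℕ}

theorem le_inter_iff (A : HArr W n) {Y : AffineSubspace ℂ W} {S : Finset (Fin n)} :
    Y ≤ A.inter S ↔ Y ≤ A.amb ∧ ∀ i ∈ S, Y ≤ A.H i := by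
  simp [inter, le_inf_iff, Finset.le_inf_iff]

theorem inter_anti (A : HArr W n) {S T : Finset (Fin n)} (h : S ⊆ T) :
    A.inter T ≤ A.inter S :=
  inf_le_inf_left _ (Finset.inf_mono h)

theorem inter_insert (A : HArr W n) (i : Fin n) (S : Finset (Fin n)) :
    A.inter (insert i S) = A.inter S ⊓ A.H i := by
  rw [inter, inter, Finset.inf_insert, inf_comm (A.H i), inf_assoc]

theorem finrank_direction_mono [FiniteDimensional ℂ W] {Y Z : AffineSubspace ℂ W} (h : Y ≤ Z) :
    finrank ℂ Y.direction ≤ finrank ℂ Z.direction :=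
  Submodule.finrank_mono (AffineSubspace.direction_le h)

theorem finrank_direction_lt [FiniteDimensional ℂ W] {Y Z : AffineSubspace ℂ W} (h : Y < Z)
    (hY : Y ≠ ⊥) : finrank ℂ Y.direction < finrank ℂ Z.direction :=
  Submodule.finrank_lt_finrank_of_lt (AffineSubspace.direction_lt_of_nonempty h
    ((AffineSubspace.nonempty_iff_ne_bot Y).2 hY))

theorem eq_of_le_of_finrank_direction_le [FiniteDimensional ℂ W] {Y Z : AffineSubspace ℂ W}
    (h : Y ≤ Z) (hY : Y ≠ ⊥) (hd : finrank ℂ Z.direction ≤ finrank ℂ Y.direction) : Y = Z := by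
  by_contra hne
  exact absurd (finrank_direction_lt (lt_of_le_of_ne h hne) hY) hd.not_gt

/-- Cutting with one hyperplane lowers the dimension by at most one. -/
theorem finrank_inter_le_insert [FiniteDimensional ℂ W] (A : HArr W n) (i : Fin n)
    (S : Finset (Fin n)) (h : A.inter (insert i S) ≠ ⊥) :
    finrank ℂ (A.inter S).direction ≤ finrank ℂ (A.inter (insert i S)).direction + 1 := by
  rw [inter_insert] at h ⊢
  obtain ⟨p, hp⟩ := (AffineSubspace.nonempty_iff_ne_bot _).2 h
  rw [AffineSubspace.direction_inf_of_mem hp.1 hp.2]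
  have hsum := Submodule.finrank_sup_add_finrank_inf_eq (A.inter S).direction (A.H i).direction
  have hsup : finrank ℂ ↥((A.inter S).direction ⊔ (A.H i).direction) ≤
      finrank ℂ A.amb.direction :=
    Submodule.finrank_mono (sup_le (AffineSubspace.direction_le inf_le_left)
      (AffineSubspace.direction_le (A.le_amb i)))
  have := A.hyp i
  omega

theorem finrank_inter_le_union [FiniteDimensional ℂ W] (A : HArr W n) (T U : Finset (Fin n))
    (h : A.inter (U ∪ T) ≠ ⊥) :
    finrank ℂ (A.inter T).direction ≤ finrank ℂ (A.inter (U ∪ T)).direction + U.card := by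
  induction U using Finset.induction_on with
  | empty => rw [Finset.empty_union, Finset.card_empty, Nat.add_zero]
  | insert i U hi ih =>
    rw [Finset.insert_union] at h ⊢
    have h1 := A.finrank_inter_le_insert i _ h
    have h2 := ih (ne_bot_of_le_ne_bot h (A.inter_anti (Finset.subset_insert i _)))
    rw [Finset.card_insert_of_notMem hi]
    omega

theorem indep.finrank_add_card [FiniteDimensional ℂ W] {A : HArr W n} {S : Finset (Fin n)}
    (h : A.indep S) :
    finrank ℂ (A.inter S).direction + S.card = finrank ℂ A.amb.direction := by
  have h1 := h.2
  have h2 : finrank ℂ (A.inter S).direction ≤ finrank ℂ A.amb.direction :=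
    finrank_direction_mono inf_le_left
  unfold cd at h1
  omega

theorem indep.finrank_add_card_le_of_subset [FiniteDimensional ℂ W] {A : HArr W n}
    {S T : Finset (Fin n)} (h : A.indep S) (hT : T ⊆ S) :
    finrank ℂ (A.inter T).direction + T.card ≤ finrank ℂ A.amb.direction := by
  have h1 := h.finrank_add_card
  have hu : (S \ T) ∪ T = S := Finset.sdiff_union_of_subset hT
  have h2 := A.finrank_inter_le_union T (S \ T) (hu.symm ▸ h.1)
  rw [hu] at h2
  have h3 := Finset.card_sdiff_add_card_eq_card hT
  omega

/-- The intersection of a base is maximal in the intersection poset. -/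
theorem isBase.inter_maximalL [FiniteDimensional ℂ W] {A : HArr W n} {S : Finset (Fin n)}
    (h : A.isBase S) : A.maximalL (A.inter S) := by
  refine ⟨⟨h.1.1, S, rfl⟩, ?_⟩
  rintro _ ⟨hne, T, rfl⟩ hle
  refine le_antisymm hle (A.le_inter_iff.2 ⟨inf_le_left, fun i hi => ?_⟩)
  by_contra hi'
  have hle' : A.inter T ≤ A.inter (insert i S) := by
    rw [inter_insert]
    exact le_inf hle ((A.le_inter_iff.1 le_rfl).2 i hi)
  have hbot := ne_bot_of_le_ne_bot hne hle'
  have hlt : A.inter (insert i S) < A.inter S := by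
    rw [inter_insert]
    exact inf_lt_left.2 hi'
  have h1 := finrank_direction_lt hlt hbot
  have h2 := A.finrank_inter_le_insert i S hbot
  have h3 := h.1.finrank_add_card
  have hiS : i ∉ S := fun hmem => hi' ((A.le_inter_iff.1 le_rfl).2 i hmem)
  have hind : A.indep (insert i S) := by
    refine ⟨hbot, ?_⟩
    rw [Finset.card_insert_of_notMem hiS, cd]
    omega
  exact hiS ((h.2 _ hind (Finset.subset_insert i S)) ▸ Finset.mem_insert_self i S)

theorem mem_sub (A : HArr W n) {Y : AffineSubspace ℂ W} {i : Fin n} :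
    i ∈ A.sub Y ↔ Y ≤ A.H i := by
  simp [sub]

theorem tup_one_eq {S : Finset (Fin n)} {f : Fin S.card → Fin n} (hf : StrictMono f)
    (hS : ∀ k, f k ∈ S) (k : Fin S.card) : tup 1 S k = f k := by
  have h := Finset.orderEmbOfFin_unique
    (Finset.card_image_of_injective S (1 : Equiv.Perm (Fin n)).injective)
    (f := f) (fun x => by simpa using hS x) hf
  rw [h]
  rfl

end HArr

open scoped Classical
/-- If `B` is a standard ordered nbc-base and `ξ = (X_1 > ⋯ > X_r)` is a
chain in `L ∖ {V}` whose set of minima `{min 𝒜_{X_k}}` equals the underlying set of `B`,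
then `ξ = ξ(B)`. -/
theorem chain_eq_flag_of_min_eq {W : Type} [AddCommGroup W] [Module ℂ W]
    [FiniteDimensional ℂ W] {n : ℕ} (A : HArr W n) (S : Finset (Fin n))
    (hS : A.nbcBase 1 S)
    (X : Fin S.card → AffineSubspace ℂ W)
    (hL : ∀ k, A.memL (X k) ∧ X k ≠ A.amb)
    (hchain : ∀ k l : Fin S.card, k < l → X k < X l)
    (mn : Fin S.card → Fin n)
    (hmn : ∀ k, HArr.isMin 1 (mn k) (A.sub (X k)))
    (him : Finset.univ.image mn = S) :
    ∀ k, X k = A.flag 1 S k := by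
  have hX : ∀ k, X k ≠ ⊥ := fun k => (hL k).1.1
  have hmono : Monotone X := by
    intro k l hkl
    rcases hkl.eq_or_lt with rfl | hlt
    · exact le_rfl
    · exact (hchain k l hlt).le
  have hmnX : ∀ k, X k ≤ A.H (mn k) := fun k => A.mem_sub.1 (hmn k).1
  have hmem : ∀ k, mn k ∈ S := fun k => by
    rw [← him]
    exact Finset.mem_image_of_mem _ (Finset.mem_univ k)
  have hinj : Function.Injective mn := by
    rw [← Set.injOn_univ, ← Finset.coe_univ, ← Finset.card_image_iff, him, Finset.card_fin]
  have hstrict : StrictMono mn := by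
    refine Monotone.strictMono_of_injective (fun k l hkl => ?_) hinj
    exact (hmn k).2 _ (A.mem_sub.2 ((hmono hkl).trans (hmnX l)))
  have hfilter : ∀ k, (S.filter fun i => mn k ≤ i) = (Finset.Ici k).image mn := by
    intro k
    ext i
    simp only [Finset.mem_filter, Finset.mem_image, Finset.mem_Ici]
    constructor
    · rintro ⟨hi, hki⟩
      rw [← him] at hi
      obtain ⟨l, -, rfl⟩ := Finset.mem_image.1 hi
      exact ⟨l, hstrict.le_iff_le.1 hki, rfl⟩
    · rintro ⟨l, hl, rfl⟩
      exact ⟨hmem l, hstrict.monotone hl⟩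
  have hflag : ∀ k, A.flag 1 S k = A.inter ((Finset.Ici k).image mn) := by
    intro k
    rw [← hfilter k, HArr.flag, HArr.tup_one_eq hstrict hmem]
    rfl
  have hamb : ∀ k, X k ≤ A.amb := by
    intro k
    obtain ⟨T, hT⟩ := (hL k).1.2
    exact hT ▸ inf_le_left
  have hle : ∀ k, X k ≤ A.inter ((Finset.Ici k).image mn) := by
    intro k
    refine A.le_inter_iff.2 ⟨hamb k, fun i hi => ?_⟩
    obtain ⟨l, hl, rfl⟩ := Finset.mem_image.1 hi
    exact (hmono (Finset.mem_Ici.1 hl)).trans (hmnX l)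
  have hdim : ∀ (m : ℕ) (hm : m < S.card),
      finrank ℂ (A.inter S).direction + m ≤ finrank ℂ (X ⟨m, hm⟩).direction := by
    intro m
    induction m with
    | zero =>
      intro hm
      have hle0 : X ⟨0, hm⟩ ≤ A.inter S := by
        refine A.le_inter_iff.2 ⟨hamb _, fun i hi => ?_⟩
        rw [← him] at hi
        obtain ⟨l, -, rfl⟩ := Finset.mem_image.1 hi
        exact (hmono (Fin.mk_le_of_le_val (Nat.zero_le _))).trans (hmnX l)
      rw [hS.2.inter_maximalL.2 _ (hL _).1 hle0, Nat.add_zero]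
    | succ m ih =>
      intro hm
      have h1 := ih (by omega)
      have h2 := HArr.finrank_direction_lt
        (hchain ⟨m, by omega⟩ ⟨m + 1, hm⟩ (Fin.mk_lt_mk.2 m.lt_succ_self)) (hX _)
      omega
  intro k
  rw [hflag k]
  refine HArr.eq_of_le_of_finrank_direction_le (hle k) (hX k) ?_
  have h1 := hS.2.1.finrank_add_card
  have h2 := hS.2.1.finrank_add_card_le_of_subset (T := (Finset.Ici k).image mn)
    (Finset.image_subset_iff.2 fun l _ => hmem l)
  rw [Finset.card_image_of_injective _ hinj, Fin.card_Ici] at h2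
  have h3 := hdim k k.2
  have h4 := k.2
  simp only [Fin.eta] at h3
  omega
end
end

section
/- Let B = (H_{i_1}, …, H_{i_r}) be a standard ordered nbc-base of 𝒜 and let B' = (H'_{i_1}, …, H'_{i_r}) be any ordered nbc-base (an ordered tuple of hyperplanes whose underlying set is an nbc-base). Then ξ(B) = ξ(B') if and only if B = B' (as ordered tuples). -/
open Module

noncomputable section

namespace HArr

variable {W : Type} [AddCommGroup W] [Module ℂ W] {n : ℕ}

/-- The `σ`-values of `tup σ S` increase strictly. -/
theorem strictMono_apply_tup (σ : Equiv.Perm (Fin n)) (S : Finset (Fin n)) :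
    StrictMono fun p => σ (tup σ S p) := by
  intro p q hpq
  simpa [tup] using hpq

theorem tup_mem (σ : Equiv.Perm (Fin n)) (S : Finset (Fin n)) (p : Fin S.card) :
    tup σ S p ∈ S := by
  obtain ⟨i, hi, h⟩ := Finset.mem_image.1
    ((S.image ⇑σ).orderIsoOfFin (Finset.card_image_of_injective S σ.injective) p).2
  simpa [tup, ← h] using hi

theorem exists_tup_eq (σ : Equiv.Perm (Fin n)) {S : Finset (Fin n)} {i : Fin n} (hi : i ∈ S) :
    ∃ p, tup σ S p = i := by
  obtain ⟨p, hp⟩ := ((S.image ⇑σ).orderIsoOfFin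
    (Finset.card_image_of_injective S σ.injective)).surjective
      ⟨σ i, Finset.mem_image_of_mem σ hi⟩
  exact ⟨p, by rw [tup, hp]; simp⟩

theorem inter_le_H (A : HArr W n) {i : Fin n} {S : Finset (Fin n)} (hi : i ∈ S) :
    A.inter S ≤ A.H i :=
  inf_le_right.trans (Finset.inf_le hi)

theorem cd_inter_empty (A : HArr W n) : A.cd (A.inter ∅) = 0 := by
  rw [cd, inter, Finset.inf_empty, inf_top_eq, Nat.sub_self]

/-- Intersecting with one more hyperplane raises the codimension by at most one. -/
theorem cd_inter_insert_le [FiniteDimensional ℂ W] (A : HArr W n) (i : Fin n)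
    (S : Finset (Fin n)) (h : A.inter (insert i S) ≠ ⊥) :
    A.cd (A.inter (insert i S)) ≤ A.cd (A.inter S) + 1 := by
  rw [inter_insert] at h ⊢
  obtain ⟨x, hx⟩ := (AffineSubspace.nonempty_iff_ne_bot _).2 h
  have hdir := AffineSubspace.direction_inf_of_mem_inf hx
  have hdim := Submodule.finrank_sup_add_finrank_inf_eq
    (A.inter S).direction (A.H i).direction
  have hsup : finrank ℂ ↥((A.inter S).direction ⊔ (A.H i).direction) ≤
      finrank ℂ A.amb.direction :=
    Submodule.finrank_mono (sup_le (AffineSubspace.direction_le inf_le_left)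
      (AffineSubspace.direction_le (A.le_amb i)))
  have hyp := A.hyp i
  rw [cd, cd, hdir]
  omega

theorem cd_inter_union_le [FiniteDimensional ℂ W] (A : HArr W n) (S D : Finset (Fin n))
    (h : A.inter (D ∪ S) ≠ ⊥) : A.cd (A.inter (D ∪ S)) ≤ A.cd (A.inter S) + D.card := by
  induction D using Finset.induction_on with
  | empty => simp
  | insert i D hi ih =>
    rw [Finset.insert_union] at h ⊢
    have hD := ih fun h0 => h (le_bot_iff.1 (h0 ▸ A.inter_anti (Finset.subset_insert _ _)))
    have hstep := A.cd_inter_insert_le i _ h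
    rw [Finset.card_insert_of_notMem hi]
    omega

theorem cd_inter_le_card [FiniteDimensional ℂ W] (A : HArr W n) {S : Finset (Fin n)}
    (h : A.inter S ≠ ⊥) : A.cd (A.inter S) ≤ S.card := by
  simpa [cd_inter_empty] using A.cd_inter_union_le ∅ S (by simpa using h)

theorem indep.not_dep_of_subset [FiniteDimensional ℂ W] {A : HArr W n} {S T : Finset (Fin n)}
    (hS : A.indep S) (hT : T ⊆ S) : ¬ A.dep T := by
  rintro ⟨-, hlt⟩
  have h := A.cd_inter_union_le T (S \ T) (by rw [Finset.sdiff_union_of_subset hT]; exact hS.1)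
  rw [Finset.sdiff_union_of_subset hT, hS.2] at h
  have hcard := Finset.card_sdiff_add_card_eq_card hT
  omega

/-- If a subset `T` of an independent nbc set has `⋂ T ⊆ H i`, then `i` is not smaller than
all elements of `T`. -/
theorem nbcSet.exists_le [FiniteDimensional ℂ W] {A : HArr W n} {σ : Equiv.Perm (Fin n)}
    {S T : Finset (Fin n)} (hS : A.nbcSet σ S) (hI : A.indep S) (hT : T ⊆ S) {i : Fin n}
    (hi : A.inter T ≤ A.H i) : ∃ j ∈ T, σ j ≤ σ i := by
  by_contra! hlt
  have hiT : i ∉ T := fun h => (hlt i h).false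
  have hne : A.inter T ≠ ⊥ := fun h0 => hS.1 (le_bot_iff.1 (h0 ▸ A.inter_anti hT))
  have hdep : A.dep (insert i T) := by
    rw [dep, inter_insert, inf_eq_left.2 hi, Finset.card_insert_of_notMem hiT]
    exact ⟨hne, Nat.lt_succ_of_le (A.cd_inter_le_card hne)⟩
  obtain ⟨C, hC, hmin⟩ := exists_minimal_le_of_wellFoundedLT A.dep _ hdep
  have hiC : i ∈ C := by
    by_contra hiC
    exact hI.not_dep_of_subset (((Finset.subset_insert_iff_of_notMem hiC).1 hC).trans hT) hmin.1
  have hCT : C.erase i ⊆ T := Finset.subset_insert_iff.1 hC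
  refine hS.2 _ (hCT.trans hT) ⟨i, Finset.notMem_erase i C, fun j hj => hlt j (hCT hj), ?_⟩
  rw [Finset.insert_erase hiC]
  exact ⟨hmin.1, fun U hU hd => hU.2 (hmin.2 hd hU.1)⟩

end HArr

open scoped Classical
/-- If `B` is a standard ordered nbc-base and `B'` any ordered nbc-base,
then `ξ(B) = ξ(B')` iff `B = B'` as ordered tuples. -/
theorem flag_eq_iff_tuple_eq {W : Type} [AddCommGroup W] [Module ℂ W]
    [FiniteDimensional ℂ W] {n : ℕ} (A : HArr W n) (S : Finset (Fin n))
    (hS : A.nbcBase 1 S)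
    (b' : Fin S.card → Fin n) (hinj : Function.Injective b')
    (hb' : A.nbcBase 1 (Finset.univ.image b')) :
    (∀ p : Fin S.card,
        A.flag 1 S p = A.inter ((Finset.univ.filter fun k => p ≤ k).image b')) ↔
      ∀ p, b' p = HArr.tup 1 S p := by
  have hmono : StrictMono (HArr.tup 1 S) := HArr.strictMono_apply_tup 1 S
  constructor
  · intro hflag p
    have hle : ∀ q i, A.flag 1 S q ≤ A.H i → HArr.tup 1 S q ≤ i := fun q i hi => by
      obtain ⟨j, hj, hji⟩ := hS.1.exists_le hS.2.1 (Finset.filter_subset _ S) hi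
      exact (Finset.mem_filter.1 hj).2.trans hji
    have hle' : ∀ k q, q ≤ k → HArr.tup 1 S q ≤ b' k := fun k q hqk =>
      hle q _ (hflag q ▸ A.inter_le_H (Finset.mem_image_of_mem b' (by simpa using hqk)))
    have hmem : A.flag 1 S p ≤ A.H (HArr.tup 1 S p) :=
      A.inter_le_H (Finset.mem_filter.2 ⟨HArr.tup_mem 1 S p, le_rfl⟩)
    rw [hflag p] at hmem
    obtain ⟨j, hj, hjp⟩ := hb'.1.exists_le hb'.2.1
      (Finset.image_subset_image (Finset.filter_subset _ _)) hmem
    obtain ⟨k, hk, rfl⟩ := Finset.mem_image.1 hj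
    have hpk : p ≤ k := (Finset.mem_filter.1 hk).2
    have hkp : k ≤ p := hmono.le_iff_le.1 ((hle' k k le_rfl).trans hjp)
    obtain rfl := le_antisymm hpk hkp
    exact le_antisymm hjp (hle' _ _ le_rfl)
  · intro hb p
    have hset : (S.filter fun i => HArr.tup 1 S p ≤ i) =
        (Finset.univ.filter fun k => p ≤ k).image b' := by
      ext i
      simp only [Finset.mem_filter, Finset.mem_image, Finset.mem_univ, true_and, hb]
      constructor
      · rintro ⟨hi, hpi⟩
        obtain ⟨k, rfl⟩ := HArr.exists_tup_eq 1 hi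
        exact ⟨k, hmono.le_iff_le.1 hpi, rfl⟩
      · rintro ⟨k, hpk, rfl⟩
        exact ⟨HArr.tup_mem 1 S k, hmono.monotone hpk⟩
    rw [← hset]
    rfl
end
end
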